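/- arXiv:1910.05634 — 2 statements merged into one kernel-verified Lean document; each statement's English description precedes it below -/
import Mathlib

section
/- Let C be an (n,k)_q MDS code containing the zero word 0̄, with n < q + k - 1. Then C contains a codeword of full weight n; that is, n ∈ W(C). -/
/-- `C ⊆ A^n` is an `(n,k)_q` MDS code: it has `q^k` codewords and its minimum
Hamming distance equals `n - k + 1`. -/
def IsMDS {A : Type*} [DecidableEq A] {n : ℕ} (q k : ℕ) (C : Finset (Fin n → A)) : Prop :=
  C.card = q ^ k ∧
    (∀ x ∈ C, ∀ y ∈ C, x ≠ y → n - k + 1 ≤ hammingDist x y) ∧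
    (∃ x ∈ C, ∃ y ∈ C, x ≠ y ∧ hammingDist x y = n - k + 1)

/-- The Hamming weight of a word `c : Fin n → A` relative to a distinguished
zero element `z` of the alphabet: the number of coordinates different from `z`. -/
def wt {A : Type*} [DecidableEq A] {n : ℕ} (z : A) (c : Fin n → A) : ℕ :=
  (Finset.univ.filter fun i => c i ≠ z).card

/-- Two codes are equivalent if one is obtained from the other by a permutation
`σ` of the coordinate positions together with a permutation `π i` of the alphabet
applied in each position `i`. -/
def CodeEquiv {A : Type*} [DecidableEq A] {n : ℕ} (C C' : Finset (Fin n → A)) : Prop :=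
  ∃ (σ : Equiv.Perm (Fin n)) (π : Fin n → Equiv.Perm A),
    C' = C.image fun c => fun i => π i (c (σ i))

/-- Words agreeing on a set `T` of positions are at distance at most `n - |T|`. -/
theorem hammingDist_add_card_le {A : Type*} [DecidableEq A] {n : ℕ} {x y : Fin n → A}
    (T : Finset (Fin n)) (hT : ∀ i ∈ T, x i = y i) : hammingDist x y + T.card ≤ n := by
  have hd : Disjoint (Finset.univ.filter fun i => x i ≠ y i) T := by
    rw [Finset.disjoint_left]
    intro i hi hiT
    exact (Finset.mem_filter.1 hi).2 (hT i hiT)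
  have h := Finset.card_le_univ ((Finset.univ.filter fun i => x i ≠ y i) ∪ T)
  rw [Finset.card_union_of_disjoint hd, Fintype.card_fin] at h
  exact h

/-- Two codewords of an MDS code agreeing on at least `k` positions coincide. -/
theorem IsMDS.eq_of_agree {A : Type*} [DecidableEq A] {n q k : ℕ} {C : Finset (Fin n → A)}
    (hC : IsMDS q k C) {x y : Fin n → A} (hx : x ∈ C) (hy : y ∈ C)
    (T : Finset (Fin n)) (hk : k ≤ T.card) (hT : ∀ i ∈ T, x i = y i) : x = y := by
  by_contra hne
  have h1 := hC.2.1 x hx y hy hne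
  have h2 := hammingDist_add_card_le T hT
  omega

/-- The length of an MDS code over an alphabet of size `q ≥ 2` is at least its dimension. -/
theorem IsMDS.dim_le_length {A : Type*} [Fintype A] [DecidableEq A] {n q k : ℕ}
    {C : Finset (Fin n → A)} (hC : IsMDS q k C) (hq : 2 ≤ q) (hA : Fintype.card A = q) :
    k ≤ n := by
  have h := Finset.card_le_univ C
  rw [hC.1, Fintype.card_fun, hA, Fintype.card_fin] at h
  exact (Nat.pow_le_pow_iff_right hq).1 h

/-- The first `k` positions of an MDS code form an information set. -/
theorem IsMDS.exists_initial_eq {A : Type*} [Fintype A] [DecidableEq A] {n q k : ℕ}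
    {C : Finset (Fin n → A)} (hC : IsMDS q k C) (hA : Fintype.card A = q) (hkn : k ≤ n)
    (a : Fin k → A) : ∃ c ∈ C, ∀ i : Fin k, c (Fin.castLE hkn i) = a i := by
  have hinj : Set.InjOn (fun (c : Fin n → A) (i : Fin k) => c (Fin.castLE hkn i)) C := by
    intro x hx y hy hxy
    refine hC.eq_of_agree hx hy (Finset.univ.map (Fin.castLEEmb hkn)) (by simp) ?_
    intro i hi
    obtain ⟨j, -, rfl⟩ := Finset.mem_map.1 hi
    exact congrFun hxy j
  have himg : C.image (fun (c : Fin n → A) (i : Fin k) => c (Fin.castLE hkn i)) =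
      Finset.univ := by
    rw [← Finset.card_eq_iff_eq_univ, Finset.card_image_of_injOn hinj, hC.1, Fintype.card_fun,
      hA, Fintype.card_fin]
  obtain ⟨c, hc, hca⟩ := Finset.mem_image.1 (himg ▸ Finset.mem_univ a)
  exact ⟨c, hc, congrFun hca⟩

/-- an `(n,k)_q` MDS code containing the zero word, with
`n < q + k - 1`, contains a codeword of full weight `n`. -/
theorem stmt_7 {A : Type*} [Fintype A] [DecidableEq A] {q n k : ℕ}
    (hq : 2 ≤ q) (hA : Fintype.card A = q) (z : A)
    (C : Finset (Fin n → A)) (hC : IsMDS q k C)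
    (h0 : (fun _ : Fin n => z) ∈ C) (hn : n < q + k - 1) :
    ∃ c ∈ C, wt z c = n := by
  have hkn := hC.dim_le_length hq hA
  obtain ⟨m, rfl⟩ : ∃ m, k = m + 1 := by
    refine Nat.exists_eq_succ_of_ne_zero ?_
    rintro rfl
    obtain ⟨x, hx, y, hy, hne, -⟩ := hC.2.2
    exact hne (hC.eq_of_agree hx hy ∅ le_rfl (by simp))
  have : Nontrivial A := Fintype.one_lt_card_iff_nontrivial.1 (by omega)
  obtain ⟨u, hu⟩ := exists_ne z
  choose f hfC hf using fun b : A =>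
    hC.exists_initial_eq hA hkn (Fin.snoc (α := fun _ => A) (fun _ : Fin m => u) b)
  have hfu : ∀ b (i : Fin n), i.val < m → f b i = u := by
    intro b i hi
    have h := hf b (Fin.castSucc ⟨i, hi⟩)
    rwa [Fin.snoc_castSucc] at h
  have hfb : ∀ b, f b (Fin.castLE hkn (Fin.last m)) = b := by
    intro b
    rw [hf, Fin.snoc_last]
  by_contra! hno
  have hzero : ∀ b, ∃ i, f b i = z := by
    intro b
    by_contra! hb
    refine hno (f b) (hfC b) ?_
    simp [wt, hb]
  choose g hg using hzero
  have hgm : ∀ b, m ≤ (g b).val := by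
    intro b
    by_contra! hlt
    exact hu ((hfu b (g b) hlt).symm.trans (hg b))
  have hginj : Function.Injective fun b => (g b).val := by
    intro b b' hbb
    have hgg : g b = g b' := Fin.ext hbb
    have hm : m < n := hkn
    have hfeq : f b = f b' := by
      refine hC.eq_of_agree (hfC b) (hfC b')
        (insert (g b) (Finset.univ.map (Fin.castLEEmb hm.le))) ?_ ?_
      · rw [Finset.card_insert_of_notMem]
        · simp
        · intro hmem
          obtain ⟨j, -, hj⟩ := Finset.mem_map.1 hmem
          have h1 := hgm b
          rw [← hj] at h1
          exact absurd j.isLt (not_lt.2 h1)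
      · intro i hi
        rcases Finset.mem_insert.1 hi with rfl | hi
        · rw [hg b, hgg, hg b']
        · obtain ⟨j, -, rfl⟩ := Finset.mem_map.1 hi
          rw [hfu b _ j.isLt, hfu b' _ j.isLt]
    rw [← hfb b, hfeq, hfb b']
  have hcard : (Finset.univ : Finset A).card ≤ (Finset.Ico m n).card :=
    Finset.card_le_card_of_injOn (fun b => (g b).val)
      (fun b _ => by simpa using hgm b) hginj.injOn
  rw [Finset.card_univ, hA, Nat.card_Ico] at hcard
  omega
end

section
/- Let C be an (n,k)_q MDS code with n = q + k - 1 and q > 2, and let c ∈ C. Then for an integer t there exists a codeword x ∈ C with x ≠ c and d(c, x) = n - t if and only if 0 ≤ t ≤ k - 1 and n - t ≠ q + 1. Equivalently, { d(c,x) : x ∈ C, x ≠ c } = { n - t : 0 ≤ t ≤ k - 1 } \ {q+1}. -/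
/-- In an MDS code of dimension `m` over an alphabet of size `q`, the number of codewords that
differ from a fixed codeword in each of `s` given coordinates. -/
def avoidCount (q : ℤ) : ℕ → ℕ → ℤ
  | 0, m => q ^ m
  | _ + 1, 0 => 0
  | s + 1, m + 1 => avoidCount q s (m + 1) - avoidCount q s m

lemma avoidCount_add_right (q : ℤ) (s d : ℕ) :
    avoidCount q s (s + d) = (q - 1) ^ s * q ^ d := by
  induction s generalizing d with
  | zero => simp [avoidCount]
  | succ s ih =>
    have h1 := ih (d + 1)
    have h2 := ih d
    rw [show s + 1 + d = (s + d) + 1 by ring, avoidCount, h2,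
      show s + d + 1 = s + (d + 1) by ring, h1]
    ring

lemma avoidCount_self (q : ℤ) (s : ℕ) : avoidCount q s s = (q - 1) ^ s := by
  simpa using avoidCount_add_right q s 0

lemma avoidCount_succ_one (q : ℤ) (s : ℕ) : avoidCount q (s + 1) 1 = q - 1 := by
  induction s with
  | zero => simp [avoidCount]
  | succ s ih => rw [avoidCount, ih]; simp [avoidCount]

lemma avoidCount_diagonal_succ (q : ℤ) (m r : ℕ) :
    avoidCount q (m + r + 2) (m + 1) =
      (q - 1) * avoidCount q (m + r + 1) m + (q - 1) * ((-1) ^ m * ((r + m).choose m : ℤ)) := by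
  induction m generalizing r with
  | zero =>
    have h := avoidCount_succ_one q (r + 1)
    rw [show 0 + r + 2 = r + 1 + 1 by ring, h]
    simp [avoidCount]
  | succ m ihm =>
    induction r with
    | zero =>
      have h1 := avoidCount_self q (m + 2)
      have h2 := avoidCount_self q (m + 1)
      have h3 := ihm 0
      have e1 : avoidCount q (m + 1 + 0 + 2) (m + 1 + 1) =
        avoidCount q (m + 2) (m + 2) - avoidCount q (m + 2) (m + 1) := rfl
      have e2 : avoidCount q (m + 1 + 0 + 1) (m + 1) =
        avoidCount q (m + 1) (m + 1) - avoidCount q (m + 1) m := rfl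
      simp only [add_zero, zero_add, Nat.choose_self] at h3 e1 e2 ⊢
      rw [h2, show m + 1 + 1 = m + 2 by ring, h3] at e2
      rw [e1, h1, h3]
      push_cast at e2 ⊢
      linear_combination (-(q - 1)) * e2
    | succ r ihr =>
      have h3 := ihm (r + 1)
      have e1 : avoidCount q (m + 1 + (r + 1) + 2) (m + 1 + 1) =
        avoidCount q (m + 1 + r + 2) (m + 1 + 1) - avoidCount q (m + (r + 1) + 2) (m + 1) := by
        rw [show m + 1 + (r + 1) + 2 = (m + 1 + r + 2) + 1 by ring, avoidCount,
          show m + (r + 1) + 2 = m + 1 + r + 2 by ring]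
      have e2 : avoidCount q (m + 1 + (r + 1) + 1) (m + 1) =
        avoidCount q (m + 1 + r + 1) (m + 1) - avoidCount q (m + (r + 1) + 1) m := by
        rw [show m + 1 + (r + 1) + 1 = (m + 1 + r + 1) + 1 by ring, avoidCount,
          show m + (r + 1) + 1 = m + 1 + r + 1 by ring]
      have hp : (r + 1 + (m + 1)).choose (m + 1) =
          (r + 1 + m).choose m + (r + (m + 1)).choose (m + 1) := by
        rw [show r + 1 + (m + 1) = (r + 1 + m) + 1 by ring, Nat.choose_succ_succ,
          show r + (m + 1) = r + 1 + m by ring]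
      rw [e1, e2, ihr, h3, hp]
      push_cast
      ring

lemma choose_succ_lt_mul_choose (p m : ℕ) (hp : 1 < p) (hm : 0 < m) :
    (p - 1 + (m + 1)).choose (m + 1) < p * (p - 1 + m).choose m := by
  obtain ⟨r, rfl⟩ : ∃ r, p = r + 1 := ⟨p - 1, by omega⟩
  have h := Nat.add_one_mul_choose_eq (r + m) m
  have hpos : 0 < (r + m).choose m := Nat.choose_pos (by omega)
  have hr : 0 < r * m := Nat.mul_pos (by omega) hm
  simp only [Nat.add_sub_cancel, ← add_assoc]
  refine Nat.lt_of_mul_lt_mul_right (a := m + 1) ?_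
  rw [← h]
  nlinarith [Nat.mul_pos hr hpos]

lemma avoidCount_diagonal_two (p : ℕ) (hp : 1 < p) :
    avoidCount (p + 1) (p + 2) 2 = 0 := by
  obtain ⟨r, rfl⟩ : ∃ r, p = r + 1 := ⟨p - 1, by omega⟩
  have h := avoidCount_diagonal_succ ((r + 1 : ℕ) + 1) 1 r
  rw [show 1 + r + 1 = (r + 1) + 1 by ring, avoidCount_succ_one] at h
  rw [show r + 1 + 2 = 1 + r + 2 by ring, h]
  push_cast [Nat.choose_one_right]
  ring

lemma avoidCount_diagonal_pos (p m : ℕ) (hp : 1 < p) (hm : 0 < m) (hm2 : m ≠ 2) :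
    0 < avoidCount (p + 1) (p + m) m := by
  have succ (m : ℕ) : avoidCount (p + 1) (p + (m + 1)) (m + 1) =
      p * avoidCount (p + 1) (p + m) m + p * ((-1) ^ m * ((p - 1 + m).choose m : ℤ)) := by
    have h := avoidCount_diagonal_succ (p + 1) m (p - 1)
    rw [show m + (p - 1) + 2 = p + (m + 1) by omega,
      show m + (p - 1) + 1 = p + m by omega] at h
    simpa using h
  have hp0 : (0 : ℤ) < p := by exact_mod_cast (by omega : 0 < p)
  have two : avoidCount (p + 1) (p + 2) 2 = 0 := avoidCount_diagonal_two p hp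
  have pair (j : ℕ) : 0 ≤ avoidCount (p + 1) (p + (2 * j + 2)) (2 * j + 2) ∧
      0 < avoidCount (p + 1) (p + (2 * j + 3)) (2 * j + 3) ∧
      0 < avoidCount (p + 1) (p + (2 * j + 4)) (2 * j + 4) := by
    have step (j : ℕ) (h0 : 0 ≤ avoidCount (p + 1) (p + (2 * j + 2)) (2 * j + 2)) :
        0 < avoidCount (p + 1) (p + (2 * j + 3)) (2 * j + 3) ∧
        0 < avoidCount (p + 1) (p + (2 * j + 4)) (2 * j + 4) := by
      have r1 := succ (2 * j + 2)
      have r2 := succ (2 * j + 3)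
      have s1 : (-1 : ℤ) ^ (2 * j + 2) = 1 := Even.neg_one_pow ⟨j + 1, by ring⟩
      have s2 : (-1 : ℤ) ^ (2 * j + 3) = -1 := Odd.neg_one_pow ⟨j + 1, by ring⟩
      rw [s1, one_mul] at r1
      rw [s2, neg_one_mul] at r2
      have c0 : (0 : ℤ) < ((p - 1 + (2 * j + 2)).choose (2 * j + 2) : ℤ) := by
        exact_mod_cast Nat.choose_pos (by omega)
      have c1 : ((p - 1 + (2 * j + 3)).choose (2 * j + 3) : ℤ) <
          p * ((p - 1 + (2 * j + 2)).choose (2 * j + 2) : ℤ) := by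
        exact_mod_cast choose_succ_lt_mul_choose p (2 * j + 2) hp (by omega)
      have b0 := mul_nonneg hp0.le h0
      have b1 := mul_pos hp0 c0
      refine ⟨by linarith, ?_⟩
      rw [show 2 * j + 4 = 2 * j + 3 + 1 by ring, r2, ← mul_add]
      refine mul_pos hp0 ?_
      linarith
    induction j with
    | zero => exact ⟨two.ge, step 0 two.ge⟩
    | succ j ih => exact ⟨ih.2.2.le, step (j + 1) ih.2.2.le⟩
  rcases Nat.even_or_odd' m with ⟨j, rfl | rfl⟩
  · obtain ⟨i, rfl⟩ : ∃ i, j = i + 2 := ⟨j - 2, by omega⟩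
    exact (pair i).2.2
  · rcases j with _ | j
    · simpa [avoidCount_succ_one] using hp0
    · exact (pair j).2.1

lemma hammingDist_add_card_agree {A : Type*} [DecidableEq A] {n : ℕ} (x y : Fin n → A) :
    hammingDist x y + (Finset.univ.filter fun i => x i = y i).card = n := by
  rw [hammingDist, add_comm]
  simpa using Finset.card_filter_add_card_filter_not (s := (Finset.univ : Finset (Fin n)))
    (fun i => x i = y i)

namespace IsMDS

variable {A : Type*} [DecidableEq A] {q n k : ℕ} {C : Finset (Fin n → A)}

lemma eq_of_agree_s19 (hC : IsMDS q k C) {x y : Fin n → A} (hx : x ∈ C) (hy : y ∈ C)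
    {K : Finset (Fin n)} (hK : K.card = k) (h : ∀ i ∈ K, x i = y i) : x = y := by
  by_contra hne
  have h1 := hC.2.1 x hx y hy hne
  have h2 := hammingDist_add_card_agree x y
  have h3 : K.card ≤ (Finset.univ.filter fun i => x i = y i).card :=
    Finset.card_le_card fun i hi => by simpa using h i hi
  omega

variable [Fintype A]

lemma exists_extension (hC : IsMDS q k C) (hA : Fintype.card A = q)
    {K : Finset (Fin n)} (hK : K.card = k) (f : Fin n → A) :
    ∃ x ∈ C, ∀ i ∈ K, x i = f i := by
  let g : C → (K → A) := fun x i => x.1 i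
  have hinj : Function.Injective g := fun x y hxy =>
    Subtype.ext (hC.eq_of_agree_s19 x.2 y.2 hK fun i hi => congrFun hxy ⟨i, hi⟩)
  have hbij : Function.Bijective g := by
    rw [Fintype.bijective_iff_injective_and_card]
    exact ⟨hinj, by simp [hC.1, hA, hK]⟩
  obtain ⟨x, hx⟩ := hbij.2 fun i => f i
  exact ⟨x, x.2, fun i hi => congrFun hx ⟨i, hi⟩⟩

lemma card_agree (hC : IsMDS q k C) (hA : Fintype.card A = q) (hkn : k ≤ n) (c : Fin n → A)
    {T : Finset (Fin n)} (hT : T.card ≤ k) :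
    (C.filter fun x => ∀ i ∈ T, x i = c i).card = q ^ (k - T.card) := by
  obtain ⟨K, hTK, hK⟩ := Finset.exists_superset_card_eq hT (by simpa using hkn)
  let g : (C.filter fun x => ∀ i ∈ T, x i = c i) → ((K \ T : Finset (Fin n)) → A) :=
    fun x i => x.1 i
  have hbij : Function.Bijective g := by
    constructor
    · intro x y hxy
      obtain ⟨hx, hxT⟩ := Finset.mem_filter.1 x.2
      obtain ⟨hy, hyT⟩ := Finset.mem_filter.1 y.2
      refine Subtype.ext (hC.eq_of_agree_s19 hx hy hK fun i hi => ?_)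
      by_cases hiT : i ∈ T
      · rw [hxT i hiT, hyT i hiT]
      · exact congrFun hxy ⟨i, Finset.mem_sdiff.2 ⟨hi, hiT⟩⟩
    · intro f
      obtain ⟨x, hx, hxf⟩ := hC.exists_extension hA hK
        fun i => if h : i ∈ K \ T then f ⟨i, h⟩ else c i
      refine ⟨⟨x, Finset.mem_filter.2 ⟨hx, fun i hi => ?_⟩⟩, funext fun i => ?_⟩
      · rw [hxf i (hTK hi), dif_neg (by simp [hi])]
      · have := hxf i (Finset.mem_sdiff.1 i.2).1
        rwa [dif_pos i.2] at this
  have := Fintype.card_of_bijective hbij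
  rw [Fintype.card_coe] at this
  rw [this, Fintype.card_fun, Fintype.card_coe, Finset.card_sdiff_of_subset hTK, hK, hA]

lemma card_agree_avoid (hC : IsMDS q k C) (hA : Fintype.card A = q) (hkn : k ≤ n)
    {c : Fin n → A} (hc : c ∈ C) (S T : Finset (Fin n)) (hT : T.card ≤ k) (hST : Disjoint S T) :
    ((C.filter fun x => (∀ i ∈ T, x i = c i) ∧ ∀ i ∈ S, x i ≠ c i).card : ℤ) =
      avoidCount q S.card (k - T.card) := by
  induction S using Finset.induction_on generalizing T with
  | empty => simp [avoidCount, hC.card_agree hA hkn c hT]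
  | insert a S ha ih =>
    rw [Finset.disjoint_insert_left] at hST
    obtain ⟨haT, hST⟩ := hST
    rw [Finset.card_insert_of_notMem ha]
    rcases hT.eq_or_lt with hT' | hT'
    · rw [hT', Nat.sub_self, avoidCount, Nat.cast_eq_zero, Finset.card_eq_zero,
        Finset.filter_eq_empty_iff]
      rintro x hx ⟨hxT, hxS⟩
      exact hxS a (Finset.mem_insert_self a S)
        (congrFun (hC.eq_of_agree_s19 hx hc hT' hxT) a)
    · have h1 := ih T hT hST
      have h2 := ih (insert a T) (by rw [Finset.card_insert_of_notMem haT]; omega)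
        (Finset.disjoint_insert_right.2 ⟨ha, hST⟩)
      rw [Finset.card_insert_of_notMem haT] at h2
      rw [show k - T.card = k - (T.card + 1) + 1 by omega] at h1 ⊢
      rw [avoidCount, ← h1, ← h2, eq_sub_iff_add_eq]
      norm_cast
      rw [← Finset.card_filter_add_card_filter_not
        (s := C.filter fun x => (∀ i ∈ T, x i = c i) ∧ ∀ i ∈ S, x i ≠ c i) (fun x => x a = c a),
        add_comm, Finset.filter_filter, Finset.filter_filter]
      congr 2 <;>
      · refine Finset.filter_congr fun x _ => ?_
        simp only [Finset.forall_mem_insert]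
        tauto

end IsMDS

/-- in an `(n,k)_q` MDS code with `n = q + k - 1` and `q > 2`,
for every codeword `c` and integer `t`, there is a codeword `x ≠ c` at distance
`n - t` from `c` if and only if `0 ≤ t ≤ k - 1` and `n - t ≠ q + 1`. -/
theorem stmt_19 {A : Type*} [Fintype A] [DecidableEq A] {q n k : ℕ}
    (hA : Fintype.card A = q) (hq : 2 < q)
    (C : Finset (Fin n → A)) (hC : IsMDS q k C) (hn : n = q + k - 1)
    (c : Fin n → A) (hc : c ∈ C) :
    ∀ t : ℕ, (∃ x ∈ C, x ≠ c ∧ hammingDist c x = n - t)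
      ↔ (t ≤ k - 1 ∧ n - t ≠ q + 1) := by
  intro t
  have hkn : k ≤ n := by omega
  have hk : 0 < k := by
    rcases Nat.eq_zero_or_pos k with rfl | hk
    · obtain ⟨x, hx, y, hy, hne, -⟩ := hC.2.2
      exact absurd (Finset.card_le_one.1 (by simp [hC.1]) x hx y hy) hne
    · exact hk
  obtain ⟨p, rfl⟩ : ∃ p, q = p + 1 := ⟨q - 1, by omega⟩
  have count (T : Finset (Fin n)) (hT : T.card ≤ k) :
      ((C.filter fun x => (∀ i ∈ T, x i = c i) ∧ ∀ i ∈ Tᶜ, x i ≠ c i).card : ℤ) =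
        avoidCount (p + 1) (p + (k - T.card)) (k - T.card) := by
    rw [hC.card_agree_avoid hA hkn hc Tᶜ T hT disjoint_compl_left, Finset.card_compl,
      Fintype.card_fin, show n - T.card = p + (k - T.card) by omega]
    norm_cast
  constructor
  · rintro ⟨x, hx, hxc, hd⟩
    have hmin := hC.2.1 c hc x hx hxc.symm
    refine ⟨by omega, fun ht => ?_⟩
    have hagree := hammingDist_add_card_agree c x
    have hcount := count (Finset.univ.filter fun i => c i = x i) (by omega)
    rw [show k - (Finset.univ.filter fun i => c i = x i).card = 2 by omega,
      avoidCount_diagonal_two p (by omega), Nat.cast_eq_zero, Finset.card_eq_zero,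
      Finset.filter_eq_empty_iff] at hcount
    exact hcount hx (by simp [eq_comm])
  · rintro ⟨ht, hne⟩
    obtain ⟨T, -, hT⟩ := Finset.exists_subset_card_eq
      (s := (Finset.univ : Finset (Fin n))) (n := t) (by simp; omega)
    have hpos := avoidCount_diagonal_pos p (k - T.card) (by omega) (by omega) (by omega)
    rw [← count T (by omega), Nat.cast_pos, Finset.card_pos] at hpos
    obtain ⟨x, hx⟩ := hpos
    obtain ⟨hx, hxT, hxS⟩ := Finset.mem_filter.1 hx
    have hd : hammingDist c x = n - t := by
      have hagree := hammingDist_add_card_agree c x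
      have : (Finset.univ.filter fun i => c i = x i) = T := by
        ext i
        simp only [Finset.mem_filter, Finset.mem_univ, true_and]
        refine ⟨fun h => ?_, fun h => (hxT i h).symm⟩
        by_contra hi
        exact hxS i (Finset.mem_compl.2 hi) h.symm
      rw [this, hT] at hagree
      omega
    refine ⟨x, hx, ?_, hd⟩
    rintro rfl
    rw [hammingDist_self] at hd
    omega
end
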